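/- Every monotone homeomorphism h : ∂S₁ → ∂S₂ between the boundaries of two strips S₁ and S₂ extends to a foliated homeomorphism ĥ : S₁ → S₂, i.e. a homeomorphism mapping each leaf of the canonical foliation of S₁ onto a leaf of the canonical foliation of S₂. -/

import Mathlib

open Set

/-- A strip: ℝ×(u,v) ⊆ S ⊆ ℝ×[u,v], open in ℝ×[u,v]. -/
def IsStrip (S : Set (ℝ × ℝ)) (u v : ℝ) : Prop :=
  u < v ∧ (univ ×ˢ Ioo u v) ⊆ S ∧ S ⊆ univ ×ˢ Icc u v ∧
  ∃ U : Set (ℝ × ℝ), IsOpen U ∧ S = U ∩ (univ ×ˢ Icc u v)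

/-- The boundary ∂S of a strip. -/
def stripBd (S : Set (ℝ × ℝ)) (u v : ℝ) : Set (ℝ × ℝ) :=
  S ∩ {p | p.2 = u ∨ p.2 = v}

/-- The partial order on the boundary of a strip: (a,x) < (b,y) iff a < b and x = y. -/
def bdLt (p q : ℝ × ℝ) : Prop := p.1 < q.1 ∧ p.2 = q.2

/-- Leaves of the canonical foliation of a subset A of the plane: connected
components of the horizontal sections of A.  For a strip these are exactly the
horizontal lines ℝ×{t}, t ∈ (u,v), together with the boundary intervals. -/
def IsLeaf (A L : Set (ℝ × ℝ)) : Prop :=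
  ∃ p ∈ A, L = connectedComponentIn ({q : ℝ × ℝ | q.2 = p.2} ∩ A) p

/-- A foliated homeomorphism of A onto B: a homeomorphism (in the subspace
topologies) mapping each leaf of the canonical foliation of A onto a leaf of the
canonical foliation of B. -/
def FoliatedHomeo (A B : Set (ℝ × ℝ)) (F : ℝ × ℝ → ℝ × ℝ) : Prop :=
  BijOn F A B ∧ ContinuousOn F A ∧
  (∃ G : ℝ × ℝ → ℝ × ℝ, InvOn G F A B ∧ ContinuousOn G B) ∧
  ∀ L, IsLeaf A L → IsLeaf B (F '' L)

/-- A bijection of boundaries is monotone if it preserves or reverses the order. -/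
def MonotoneBd (S₁ : Set (ℝ × ℝ)) (u₁ v₁ : ℝ) (h : ℝ × ℝ → ℝ × ℝ) : Prop :=
  (∀ p ∈ stripBd S₁ u₁ v₁, ∀ q ∈ stripBd S₁ u₁ v₁, (bdLt p q ↔ bdLt (h p) (h q))) ∨
  (∀ p ∈ stripBd S₁ u₁ v₁, ∀ q ∈ stripBd S₁ u₁ v₁, (bdLt p q ↔ bdLt (h q) (h p)))

lemma uniq_aux (A : Set ℝ) (f W : ℝ → ℝ) (hA : IsOpen A) (hf : ContinuousOn f A)
    (sm : StrictMonoOn f A) (hW : LipschitzWith 1 W)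
    (h : ∀ a ∈ A, W (a + f a) = a - f a) :
    ∀ a ∈ A, ∀ s, (s + W s) / 2 = a ↔ s = a + f a := by
  have hmono : ∀ s s', s ≤ s' → s + W s ≤ s' + W s' := by
    intro s s' hs
    have := hW.dist_le_mul s s'
    rw [Real.dist_eq, Real.dist_eq, abs_sub_comm s s', abs_of_nonneg (by linarith : 0 ≤ s' - s)] at this
    have := (abs_le.1 this).2
    simp at this
    linarith
  intro a ha s
  constructor
  · intro hs
    have hcont : ContinuousAt (fun x => x + f x) a :=
      continuousAt_id.add (hf.continuousAt (hA.mem_nhds ha))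
    have hn : ∀ᶠ x in nhds a, x ∈ A := hA.mem_nhds ha
    apply le_antisymm
    · refine ge_of_tendsto (hcont.tendsto.mono_left (nhdsWithin_le_nhds (s := Ioi a))) ?_
      filter_upwards [nhdsWithin_le_nhds hn, self_mem_nhdsWithin] with x hx hxa
      by_contra! hlt
      have := hmono _ _ hlt.le
      rw [h x hx] at this
      have : a < x := hxa
      linarith
    · refine le_of_tendsto (hcont.tendsto.mono_left (nhdsWithin_le_nhds (s := Iio a))) ?_
      filter_upwards [nhdsWithin_le_nhds hn, self_mem_nhdsWithin] with x hx hxa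
      by_contra! hlt
      have := hmono _ _ hlt.le
      rw [h x hx] at this
      have : x < a := hxa
      linarith
  · rintro rfl
    rw [h a ha]; ring

lemma side_aux (A B : Set ℝ) (f g : ℝ → ℝ) (hA : IsOpen A) (hB : IsOpen B)
    (hf : ContinuousOn f A) (hg : ContinuousOn g B) (mf : MapsTo f A B) (mg : MapsTo g B A)
    (li : ∀ a ∈ A, g (f a) = a) (ri : ∀ b ∈ B, f (g b) = b) (sm : StrictMonoOn f A) :
    ∃ X Y : ℝ → ℝ, Continuous X ∧ Continuous Y ∧ Monotone X ∧ Monotone Y ∧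
      (∀ x ∈ A, ∀ s, X s = x ↔ s = x + f x) ∧ (∀ y ∈ B, ∀ s, Y s = y ↔ s = y + g y) := by
  have smg : StrictMonoOn g B := by
    intro x hx y hy hxy
    by_contra! hle
    have := sm.monotoneOn (mg hy) (mg hx) hle
    rw [ri x hx, ri y hy] at this
    linarith
  have key : ∀ a ∈ A, ∀ b ∈ A, |(a - f a) - (b - f b)| ≤ |(a + f a) - (b + f b)| := by
    intro a ha b hb
    rcases le_total a b with hab | hab
    · have := sm.monotoneOn ha hb hab
      rw [abs_of_nonpos (by linarith : (a + f a) - (b + f b) ≤ 0), abs_le]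
      constructor <;> linarith
    · have := sm.monotoneOn hb ha hab
      rw [abs_of_nonneg (by linarith : 0 ≤ (a + f a) - (b + f b)), abs_le]
      constructor <;> linarith
  set T := (fun a => a + f a) '' A with hT
  set φ := Function.invFunOn (fun a => a + f a) A with hφ
  have hφA : ∀ s ∈ T, φ s ∈ A := fun s hs => Function.invFunOn_mem hs
  have hφe : ∀ s ∈ T, φ s + f (φ s) = s := fun s hs => Function.invFunOn_eq hs
  have hlip : LipschitzOnWith 1 (fun s => φ s - f (φ s)) T := by
    refine LipschitzOnWith.of_dist_le_mul ?_
    intro s hs s' hs'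
    have := key _ (hφA s hs) _ (hφA s' hs')
    rw [hφe s hs, hφe s' hs'] at this
    rw [Real.dist_eq, Real.dist_eq, NNReal.coe_one, one_mul]
    exact this
  obtain ⟨W, hW, hWe⟩ := hlip.extend_real
  have hWA : ∀ a ∈ A, W (a + f a) = a - f a := by
    intro a ha
    have hs : a + f a ∈ T := ⟨a, ha, rfl⟩
    rw [← hWe hs]
    have h1 := hφe _ hs
    have h2 := key _ (hφA _ hs) a ha
    rw [h1, sub_self, abs_zero] at h2
    have := abs_nonpos_iff.1 h2
    simp only; linarith
  have hWB : ∀ b ∈ B, (fun s => -W s) (b + g b) = b - g b := by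
    intro b hb
    have := hWA (g b) (mg hb)
    rw [ri b hb] at this
    simp only
    rw [add_comm, this]; ring
  have hW' : LipschitzWith 1 (fun s => -W s) := by
    have := hW.neg
    exact this
  have mono : ∀ V : ℝ → ℝ, LipschitzWith 1 V → Monotone (fun s => (s + V s) / 2) := by
    intro V hV s s' hs
    have := hV.dist_le_mul s s'
    rw [Real.dist_eq, Real.dist_eq, abs_sub_comm s s', abs_of_nonneg (by linarith : 0 ≤ s' - s)] at this
    have := (abs_le.1 this).2
    simp at this
    simp only
    linarith
  refine ⟨fun s => (s + W s) / 2, fun s => (s + -W s) / 2, ?_, ?_, mono _ hW, mono _ hW',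
    uniq_aux A f W hA hf sm hW hWA, uniq_aux B g _ hB hg smg hW' hWB⟩
  · have := hW.continuous
    fun_prop
  · have := hW.continuous
    fun_prop

/-- normalized strip -/
def nstrip (A0 A1 : Set ℝ) : Set (ℝ × ℝ) :=
  {p | 0 ≤ p.2 ∧ p.2 ≤ 1 ∧ (p.2 = 0 → p.1 ∈ A0) ∧ (p.2 = 1 → p.1 ∈ A1)}

/-- the interpolation -/
def interp (X0 X1 : ℝ → ℝ) (s t : ℝ) : ℝ := (1 - t) * X0 s + t * X1 s + t * (1 - t) * s

lemma interp_cont {X0 X1 : ℝ → ℝ} (c0 : Continuous X0) (c1 : Continuous X1) :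
    Continuous (fun p : ℝ × ℝ => interp X0 X1 p.1 p.2) := by
  unfold interp; fun_prop

lemma interp_mono {X0 X1 : ℝ → ℝ} (m0 : Monotone X0) (m1 : Monotone X1) {t : ℝ} (h0 : 0 ≤ t)
    (h1 : t ≤ 1) {s s' : ℝ} (hs : s ≤ s') :
    interp X0 X1 s t + t * (1 - t) * (s' - s) ≤ interp X0 X1 s' t := by
  unfold interp
  have := mul_le_mul_of_nonneg_left (m0 hs) (by linarith : 0 ≤ 1 - t)
  have := mul_le_mul_of_nonneg_left (m1 hs) h0
  linarith

lemma interp_mono' {X0 X1 : ℝ → ℝ} (m0 : Monotone X0) (m1 : Monotone X1) {t : ℝ} (h0 : 0 ≤ t)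
    (h1 : t ≤ 1) {s s' : ℝ} (hs : s ≤ s') :
    interp X0 X1 s t ≤ interp X0 X1 s' t := by
  have := interp_mono m0 m1 h0 h1 hs
  have : 0 ≤ t * (1 - t) * (s' - s) :=
    mul_nonneg (mul_nonneg h0 (by linarith)) (by linarith)
  linarith

lemma sigma_aux (A0 A1 : Set ℝ) (X0 X1 k0 k1 : ℝ → ℝ) (c0 : Continuous X0) (c1 : Continuous X1)
    (m0 : Monotone X0) (m1 : Monotone X1) (h0 : ∀ x ∈ A0, ∀ s, X0 s = x ↔ s = k0 x)
    (h1 : ∀ x ∈ A1, ∀ s, X1 s = x ↔ s = k1 x) :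
    ∃ σ : ℝ × ℝ → ℝ, ContinuousOn σ (nstrip A0 A1) ∧
      ∀ p ∈ nstrip A0 A1, ∀ s, interp X0 X1 s p.2 = p.1 ↔ s = σ p := by
  have ex : ∀ p : ℝ × ℝ, ∃ r : ℝ, p ∈ nstrip A0 A1 → ∀ s, interp X0 X1 s p.2 = p.1 ↔ s = r := by
    rintro ⟨x, t⟩
    by_cases hp : (x, t) ∈ nstrip A0 A1
    swap
    · exact ⟨0, fun h => absurd h hp⟩
    obtain ⟨ht0, ht1, hA0, hA1⟩ := hp
    simp only at ht0 ht1 hA0 hA1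
    rcases ht0.eq_or_lt with rfl | ht0'
    · refine ⟨k0 x, fun _ s => ?_⟩
      rw [← h0 x (hA0 rfl) s]; simp [interp]
    rcases ht1.eq_or_lt with rfl | ht1'
    · refine ⟨k1 x, fun _ s => ?_⟩
      rw [← h1 x (hA1 rfl) s]; simp [interp]
    have hpos : 0 < t * (1 - t) := mul_pos ht0' (by linarith)
    have hc : Continuous (fun s => interp X0 X1 s t) :=
      (interp_cont c0 c1).comp (by fun_prop : Continuous fun s : ℝ => (s, t))
    have hr : x ∈ range (fun s => interp X0 X1 s t) := by
      set c := interp X0 X1 0 t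
      set d := |x - c| / (t * (1 - t)) with hd
      have hd0 : 0 ≤ d := by positivity
      have hdd : t * (1 - t) * d = |x - c| := by rw [hd]; field_simp
      apply mem_range_of_exists_le_of_exists_ge hc
      · refine ⟨-d, ?_⟩
        have := interp_mono m0 m1 ht0 ht1 (by linarith : -d ≤ 0)
        rw [zero_sub, neg_neg, hdd] at this
        have := neg_abs_le (x - c)
        linarith
      · refine ⟨d, ?_⟩
        have := interp_mono m0 m1 ht0 ht1 hd0
        rw [sub_zero, hdd] at this
        have := le_abs_self (x - c)
        linarith
    obtain ⟨r, hr⟩ := hr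
    simp only at hr
    refine ⟨r, fun _ s => ⟨fun hs => ?_, fun hs => by rw [hs]; exact hr⟩⟩
    simp only at hs
    rcases lt_trichotomy s r with hlt | rfl | hlt
    · have := interp_mono m0 m1 ht0 ht1 hlt.le
      have := mul_pos hpos (sub_pos.2 hlt)
      linarith
    · rfl
    · have := interp_mono m0 m1 ht0 ht1 hlt.le
      have := mul_pos hpos (sub_pos.2 hlt)
      linarith
  choose σ hσ using ex
  refine ⟨σ, ?_, hσ⟩
  intro p hp
  rw [ContinuousWithinAt, Metric.tendsto_nhds]
  intro ε hε
  have hcq : ∀ s, Continuous (fun q : ℝ × ℝ => interp X0 X1 s q.2 - q.1) := fun s =>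
    ((interp_cont c0 c1).comp (by fun_prop : Continuous fun q : ℝ × ℝ => (s, q.2))).sub
      continuous_fst
  have he : interp X0 X1 (σ p) p.2 = p.1 := (hσ p hp _).2 rfl
  have hlo : interp X0 X1 (σ p - ε) p.2 - p.1 < 0 := by
    rw [sub_neg]
    refine lt_of_le_of_ne ?_ ?_
    · exact (interp_mono' m0 m1 hp.1 hp.2.1 (by linarith)).trans_eq he
    · intro h
      have := (hσ p hp _).1 h
      linarith
  have hhi : 0 < interp X0 X1 (σ p + ε) p.2 - p.1 := by
    rw [sub_pos]
    refine lt_of_le_of_ne ?_ ?_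
    · exact he.symm.trans_le (interp_mono' m0 m1 hp.1 hp.2.1 (by linarith))
    · intro h
      have := (hσ p hp _).1 h.symm
      linarith
  filter_upwards [self_mem_nhdsWithin,
    nhdsWithin_le_nhds ((hcq (σ p - ε)).continuousAt.eventually_lt_const hlo),
    nhdsWithin_le_nhds ((hcq (σ p + ε)).continuousAt.eventually_const_lt hhi)] with q hq h1 h2
  have heq : interp X0 X1 (σ q) q.2 = q.1 := (hσ q hq _).2 rfl
  rw [Real.dist_eq, abs_lt]
  constructor
  · by_contra! hle
    have := interp_mono' m0 m1 hq.1 hq.2.1 (by linarith : σ q ≤ σ p - ε)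
    linarith
  · by_contra! hle
    have := interp_mono' m0 m1 hq.1 hq.2.1 (by linarith : σ p + ε ≤ σ q)
    linarith

/-- one half of the core construction -/
lemma half_core (A0 A1 B0 B1 : Set ℝ) (f0 g0 f1 g1 X0 Y0 X1 Y1 : ℝ → ℝ) (σ τ : ℝ × ℝ → ℝ)
    (cY0 : Continuous Y0) (cY1 : Continuous Y1)
    (mf0 : MapsTo f0 A0 B0) (li0 : ∀ a ∈ A0, g0 (f0 a) = a)
    (mf1 : MapsTo f1 A1 B1) (li1 : ∀ a ∈ A1, g1 (f1 a) = a)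
    (hX0 : ∀ x ∈ A0, ∀ s, X0 s = x ↔ s = x + f0 x)
    (hY0 : ∀ y ∈ B0, ∀ s, Y0 s = y ↔ s = y + g0 y)
    (hX1 : ∀ x ∈ A1, ∀ s, X1 s = x ↔ s = x + f1 x)
    (hY1 : ∀ y ∈ B1, ∀ s, Y1 s = y ↔ s = y + g1 y)
    (cσ : ContinuousOn σ (nstrip A0 A1))
    (hσ : ∀ p ∈ nstrip A0 A1, ∀ s, interp X0 X1 s p.2 = p.1 ↔ s = σ p)
    (hτ : ∀ p ∈ nstrip B0 B1, ∀ s, interp Y0 Y1 s p.2 = p.1 ↔ s = τ p) :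
    MapsTo (fun p => (interp Y0 Y1 (σ p) p.2, p.2)) (nstrip A0 A1) (nstrip B0 B1) ∧
    ContinuousOn (fun p => (interp Y0 Y1 (σ p) p.2, p.2)) (nstrip A0 A1) ∧
    (∀ p ∈ nstrip A0 A1, τ (interp Y0 Y1 (σ p) p.2, p.2) = σ p) ∧
    (∀ p ∈ nstrip A0 A1, p.2 = 0 → interp Y0 Y1 (σ p) p.2 = f0 p.1) ∧
    (∀ p ∈ nstrip A0 A1, p.2 = 1 → interp Y0 Y1 (σ p) p.2 = f1 p.1) := by
  have e0 : ∀ p ∈ nstrip A0 A1, p.2 = 0 → interp Y0 Y1 (σ p) p.2 = f0 p.1 := by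
    rintro ⟨x, t⟩ hp rfl
    have hx : x ∈ A0 := hp.2.2.1 rfl
    have h1 := (hσ _ hp (σ (x, 0))).2 rfl
    simp only [interp, sub_zero, one_mul, zero_mul, add_zero] at h1 ⊢
    rw [hX0 x hx] at h1
    rw [hY0 _ (mf0 hx), h1, li0 x hx, add_comm]
  have e1 : ∀ p ∈ nstrip A0 A1, p.2 = 1 → interp Y0 Y1 (σ p) p.2 = f1 p.1 := by
    rintro ⟨x, t⟩ hp rfl
    have hx : x ∈ A1 := hp.2.2.2 rfl
    have h1 := (hσ _ hp (σ (x, 1))).2 rfl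
    simp only [interp, sub_self, one_mul, zero_mul, add_zero, mul_zero, zero_add] at h1 ⊢
    rw [hX1 x hx] at h1
    rw [hY1 _ (mf1 hx), h1, li1 x hx, add_comm]
  have hm : MapsTo (fun p : ℝ × ℝ => (interp Y0 Y1 (σ p) p.2, p.2))
      (nstrip A0 A1) (nstrip B0 B1) := by
    intro p hp
    refine ⟨hp.1, hp.2.1, fun h => ?_, fun h => ?_⟩
    · simp only [e0 p hp h]; exact mf0 (hp.2.2.1 h)
    · simp only [e1 p hp h]; exact mf1 (hp.2.2.2 h)
  refine ⟨hm, ?_, ?_, e0, e1⟩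
  · refine ContinuousOn.prodMk ?_ continuousOn_snd
    exact (interp_cont cY0 cY1).comp_continuousOn (cσ.prodMk continuousOn_snd)
  · intro p hp
    exact ((hτ _ (hm hp) (σ p)).1 rfl).symm

lemma core (A0 A1 B0 B1 : Set ℝ) (f0 g0 f1 g1 : ℝ → ℝ)
    (hA0 : IsOpen A0) (hB0 : IsOpen B0) (hA1 : IsOpen A1) (hB1 : IsOpen B1)
    (cf0 : ContinuousOn f0 A0) (cg0 : ContinuousOn g0 B0)
    (cf1 : ContinuousOn f1 A1) (cg1 : ContinuousOn g1 B1)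
    (mf0 : MapsTo f0 A0 B0) (mg0 : MapsTo g0 B0 A0)
    (mf1 : MapsTo f1 A1 B1) (mg1 : MapsTo g1 B1 A1)
    (li0 : ∀ a ∈ A0, g0 (f0 a) = a) (ri0 : ∀ b ∈ B0, f0 (g0 b) = b)
    (li1 : ∀ a ∈ A1, g1 (f1 a) = a) (ri1 : ∀ b ∈ B1, f1 (g1 b) = b)
    (sm0 : StrictMonoOn f0 A0) (sm1 : StrictMonoOn f1 A1) :
    ∃ F G : ℝ × ℝ → ℝ × ℝ, MapsTo F (nstrip A0 A1) (nstrip B0 B1) ∧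
      MapsTo G (nstrip B0 B1) (nstrip A0 A1) ∧
      ContinuousOn F (nstrip A0 A1) ∧ ContinuousOn G (nstrip B0 B1) ∧
      InvOn G F (nstrip A0 A1) (nstrip B0 B1) ∧
      (∀ p, (F p).2 = p.2) ∧
      (∀ x ∈ A0, F (x, 0) = (f0 x, 0)) ∧ (∀ x ∈ A1, F (x, 1) = (f1 x, 1)) := by
  obtain ⟨X0, Y0, cX0, cY0, mX0, mY0, hX0, hY0⟩ :=
    side_aux A0 B0 f0 g0 hA0 hB0 cf0 cg0 mf0 mg0 li0 ri0 sm0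
  obtain ⟨X1, Y1, cX1, cY1, mX1, mY1, hX1, hY1⟩ :=
    side_aux A1 B1 f1 g1 hA1 hB1 cf1 cg1 mf1 mg1 li1 ri1 sm1
  obtain ⟨σ, cσ, hσ⟩ := sigma_aux A0 A1 X0 X1 _ _ cX0 cX1 mX0 mX1 hX0 hX1
  obtain ⟨τ, cτ, hτ⟩ := sigma_aux B0 B1 Y0 Y1 _ _ cY0 cY1 mY0 mY1 hY0 hY1
  obtain ⟨a1, a2, a3, a4, a5⟩ := half_core A0 A1 B0 B1 f0 g0 f1 g1 X0 Y0 X1 Y1 σ τ cY0 cY1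
    mf0 li0 mf1 li1 hX0 hY0 hX1 hY1 cσ hσ hτ
  obtain ⟨b1, b2, b3, b4, b5⟩ := half_core B0 B1 A0 A1 g0 f0 g1 f1 Y0 X0 Y1 X1 τ σ cX0 cX1
    mg0 ri0 mg1 ri1 hY0 hX0 hY1 hX1 cτ hτ hσ
  refine ⟨_, _, a1, b1, a2, b2, ⟨?_, ?_⟩, fun p => rfl, ?_, ?_⟩
  · intro p hp
    simp only [a3 p hp]
    rw [(hσ p hp (σ p)).2 rfl]
  · intro p hp
    simp only [b3 p hp]
    rw [(hτ p hp (τ p)).2 rfl]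
  · intro x hx
    have := a4 (x, 0) ⟨le_rfl, zero_le_one, fun _ => hx, fun h => absurd h zero_ne_one⟩ rfl
    exact Prod.ext this rfl
  · intro x hx
    have := a5 (x, 1) ⟨zero_le_one, le_rfl, fun h => absurd h one_ne_zero, fun _ => hx⟩ rfl
    exact Prod.ext this rfl

/-- leaves go to leaves -/
lemma foliated_of_level (A B : Set (ℝ × ℝ)) (F G : ℝ × ℝ → ℝ × ℝ)
    (mF : MapsTo F A B) (mG : MapsTo G B A) (cF : ContinuousOn F A) (cG : ContinuousOn G B)
    (inv : InvOn G F A B) (lev : ∀ p ∈ A, ∀ q ∈ A, p.2 = q.2 ↔ (F p).2 = (F q).2) :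
    FoliatedHomeo A B F := by
  refine ⟨inv.bijOn mF mG, cF, ⟨G, inv, cG⟩, ?_⟩
  rintro L ⟨p, hp, rfl⟩
  refine ⟨F p, mF hp, ?_⟩
  set C := {q : ℝ × ℝ | q.2 = p.2} ∩ A with hC
  set D := {q : ℝ × ℝ | q.2 = (F p).2} ∩ B with hD
  have hpC : p ∈ C := ⟨rfl, hp⟩
  have hFp : F p ∈ D := ⟨rfl, mF hp⟩
  have sC : connectedComponentIn C p ⊆ C := connectedComponentIn_subset _ _
  have sD : connectedComponentIn D (F p) ⊆ D := connectedComponentIn_subset _ _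
  apply Subset.antisymm
  · refine IsPreconnected.subset_connectedComponentIn ?_ ?_ ?_
    · exact isPreconnected_connectedComponentIn.image F (cF.mono (sC.trans inter_subset_right))
    · exact ⟨p, mem_connectedComponentIn hpC, rfl⟩
    · rintro _ ⟨q, hq, rfl⟩
      have := sC hq
      exact ⟨(lev q this.2 p hp).1 this.1, mF this.2⟩
  · have : G '' connectedComponentIn D (F p) ⊆ connectedComponentIn C p := by
      refine IsPreconnected.subset_connectedComponentIn ?_ ?_ ?_
      · exact isPreconnected_connectedComponentIn.image G (cG.mono (sD.trans inter_subset_right))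
      · exact ⟨F p, mem_connectedComponentIn hFp, inv.1 hp⟩
      · rintro _ ⟨q, hq, rfl⟩
        have hqD := sD hq
        refine ⟨(lev (G q) (mG hqD.2) p hp).2 ?_, mG hqD.2⟩
        rw [inv.2 hqD.2]; exact hqD.1
    intro q hq
    exact ⟨G q, this ⟨q, hq, rfl⟩, inv.2 (sD hq).2⟩

lemma boundary_side (P Q : Set (ℝ × ℝ)) (h g : ℝ × ℝ → ℝ × ℝ) (mh : MapsTo h P Q)
    (mg : MapsTo g Q P) (ch : ContinuousOn h P) (cg : ContinuousOn g Q) (inv : InvOn g h P Q)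
    (e : ℝ) (he : e * e = 1) (c c' : ℝ) (lev : ∀ p ∈ P, p.2 = c ↔ (h p).2 = c')
    (mono : ∀ p ∈ P, ∀ q ∈ P, p.2 = q.2 → p.1 < q.1 → e * (h p).1 < e * (h q).1)
    (A B : Set ℝ) (hA : A = {x | (x, c) ∈ P}) (hB : B = {y | (e * y, c') ∈ Q})
    (f k : ℝ → ℝ) (hf : f = fun x => e * (h (x, c)).1) (hk : k = fun y => (g (e * y, c')).1) :
    ContinuousOn f A ∧ ContinuousOn k B ∧ MapsTo f A B ∧ MapsTo k B A ∧
      (∀ a ∈ A, k (f a) = a) ∧ (∀ b ∈ B, f (k b) = b) ∧ StrictMonoOn f A ∧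
      (∀ a ∈ A, h (a, c) = (e * f a, c')) := by
  have ee : ∀ z : ℝ, e * (e * z) = z := fun z => by rw [← mul_assoc, he, one_mul]
  have h1 : ∀ a ∈ A, h (a, c) = (e * f a, c') := by
    intro a ha
    rw [hA] at ha
    apply Prod.ext
    · simp only [hf, ee]
    · exact (lev (a, c) ha).1 rfl
  have h2 : ∀ b ∈ B, g (e * b, c') = (k b, c) := by
    intro b hb
    rw [hB] at hb
    apply Prod.ext
    · simp only [hk]
    · refine (lev _ (mg hb)).2 ?_
      rw [inv.2 hb]
  have mA : MapsTo f A B := by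
    intro a ha
    have := h1 a ha
    rw [hB, mem_setOf_eq, ← this]
    rw [hA] at ha
    exact mh ha
  have mB : MapsTo k B A := by
    intro b hb
    have := h2 b hb
    rw [hA, mem_setOf_eq, ← this]
    rw [hB] at hb
    exact mg hb
  refine ⟨?_, ?_, mA, mB, ?_, ?_, ?_, h1⟩
  · rw [hf, hA]
    refine continuousOn_const.mul (continuous_fst.comp_continuousOn ?_)
    exact ch.comp (by fun_prop : Continuous fun x : ℝ => (x, c)).continuousOn fun x hx => hx
  · rw [hk, hB]
    refine continuous_fst.comp_continuousOn ?_
    exact cg.comp (by fun_prop : Continuous fun y : ℝ => (e * y, c')).continuousOn fun x hx => hx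
  · intro a ha
    simp only [hk]
    rw [← h1 a ha]
    rw [hA] at ha
    rw [inv.1 ha]
  · intro b hb
    simp only [hf]
    rw [← h2 b hb]
    rw [hB] at hb
    rw [inv.2 hb]
    exact ee b
  · intro x hx y hy hxy
    rw [hA] at hx hy
    simp only [hf]
    exact mono _ hx _ hy rfl hxy

lemma open_side (S : Set (ℝ × ℝ)) (u v e c : ℝ) (hS : IsStrip S u v) (hc : c = u ∨ c = v) :
    IsOpen {x : ℝ | (e * x, c) ∈ stripBd S u v} := by
  obtain ⟨huv, -, -, U, hU, rfl⟩ := hS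
  have : {x : ℝ | (e * x, c) ∈ stripBd (U ∩ (univ ×ˢ Icc u v)) u v}
      = (fun x : ℝ => (e * x, c)) ⁻¹' U := by
    ext x
    have : c ∈ Icc u v := by rcases hc with rfl | rfl <;> simp [huv.le]
    simp [stripBd, hc, this.1, this.2]
  rw [this]
  exact hU.preimage (by fun_prop)

lemma strip_norm (S : Set (ℝ × ℝ)) (u v e a b : ℝ) (hS : IsStrip S u v)
    (hab : (a = u ∧ b = v) ∨ (a = v ∧ b = u)) (p : ℝ × ℝ) :
    p ∈ nstrip {x | (e * x, a) ∈ stripBd S u v} {x | (e * x, b) ∈ stripBd S u v} ↔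
      (e * p.1, a + (b - a) * p.2) ∈ S := by
  obtain ⟨huv, hin, hout, -⟩ := hS
  obtain ⟨x, t⟩ := p
  simp only [nstrip, mem_setOf_eq, stripBd]
  have key : a + (b - a) * t ∈ Icc u v ↔ 0 ≤ t ∧ t ≤ 1 := by
    rcases hab with ⟨rfl, rfl⟩ | ⟨rfl, rfl⟩
    · constructor
      · rintro ⟨h1, h2⟩
        constructor <;> nlinarith
      · rintro ⟨h1, h2⟩
        constructor <;> nlinarith
    · constructor
      · rintro ⟨h1, h2⟩
        constructor <;> nlinarith
      · rintro ⟨h1, h2⟩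
        constructor <;> nlinarith
  constructor
  · rintro ⟨h0, h1, hA, hB⟩
    rcases h0.eq_or_lt with rfl | h0'
    · simpa using (hA rfl).1
    rcases h1.eq_or_lt with rfl | h1'
    · simpa using (hB rfl).1
    apply hin
    refine ⟨trivial, ?_⟩
    rcases hab with ⟨rfl, rfl⟩ | ⟨rfl, rfl⟩
    · constructor <;> simp only <;> nlinarith
    · constructor <;> simp only <;> nlinarith
  · intro h
    obtain ⟨h0, h1⟩ := key.1 (hout h).2
    refine ⟨h0, h1, ?_, ?_⟩
    · rintro rfl
      simp only [mul_zero, add_zero] at h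
      exact ⟨h, by rcases hab with ⟨rfl, rfl⟩ | ⟨rfl, rfl⟩ <;> simp⟩
    · rintro rfl
      simp only [mul_one, add_sub_cancel] at h
      exact ⟨h, by rcases hab with ⟨rfl, rfl⟩ | ⟨rfl, rfl⟩ <;> simp⟩

/-- every monotone homeomorphism between the boundaries of two strips
extends to a foliated homeomorphism of the strips. -/
theorem stmt_4 (S₁ S₂ : Set (ℝ × ℝ)) (u₁ v₁ u₂ v₂ : ℝ)
    (hS₁ : IsStrip S₁ u₁ v₁) (hS₂ : IsStrip S₂ u₂ v₂)
    (h : ℝ × ℝ → ℝ × ℝ)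
    (hbij : BijOn h (stripBd S₁ u₁ v₁) (stripBd S₂ u₂ v₂))
    (hcont : ContinuousOn h (stripBd S₁ u₁ v₁))
    (hinv : ∃ g : ℝ × ℝ → ℝ × ℝ,
      InvOn g h (stripBd S₁ u₁ v₁) (stripBd S₂ u₂ v₂) ∧
      ContinuousOn g (stripBd S₂ u₂ v₂))
    (hmono : MonotoneBd S₁ u₁ v₁ h) :
    ∃ F : ℝ × ℝ → ℝ × ℝ, FoliatedHomeo S₁ S₂ F ∧ EqOn F h (stripBd S₁ u₁ v₁) := by
  obtain ⟨g, inv, cg⟩ := hinv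
  set P := stripBd S₁ u₁ v₁ with hP
  set Q := stripBd S₂ u₂ v₂ with hQ
  have mh : MapsTo h P Q := hbij.mapsTo
  have mg : MapsTo g Q P := by
    intro q hq
    obtain ⟨p, hp, rfl⟩ := hbij.surjOn hq
    rw [inv.1 hp]; exact hp
  have huv₁ : u₁ < v₁ := hS₁.1
  have huv₂ : u₂ < v₂ := hS₂.1
  -- orientation
  obtain ⟨e, he, mono⟩ : ∃ e : ℝ, e * e = 1 ∧
      ∀ p ∈ P, ∀ q ∈ P, p.2 = q.2 → p.1 < q.1 → e * (h p).1 < e * (h q).1 := by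
    rcases hmono with hm | hm
    · refine ⟨1, by norm_num, fun p hp q hq h2 h1 => ?_⟩
      have := ((hm p hp q hq).1 ⟨h1, h2⟩).1
      linarith
    · refine ⟨-1, by norm_num, fun p hp q hq h2 h1 => ?_⟩
      have := ((hm p hp q hq).1 ⟨h1, h2⟩).1
      linarith
  have lev : ∀ p ∈ P, ∀ q ∈ P, p.2 = q.2 ↔ (h p).2 = (h q).2 := by
    intro p hp q hq
    have comp : ∀ p q : ℝ × ℝ, p.2 = q.2 ↔ (bdLt p q ∨ bdLt q p ∨ p = q) := by
      intro p q
      constructor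
      · intro h2
        rcases lt_trichotomy p.1 q.1 with h1 | h1 | h1
        · exact Or.inl ⟨h1, h2⟩
        · exact Or.inr (Or.inr (Prod.ext h1 h2))
        · exact Or.inr (Or.inl ⟨h1, h2.symm⟩)
      · rintro (h1 | h1 | h1)
        · exact h1.2
        · exact h1.2.symm
        · rw [h1]
    rw [comp, comp, ← hbij.injOn.eq_iff hp hq]
    rcases hmono with hm | hm
    · rw [hm p hp q hq, hm q hq p hp]
    · rw [hm p hp q hq, hm q hq p hp]; tauto
  have hPl : ∀ p ∈ P, p.2 = u₁ ∨ p.2 = v₁ := fun p hp => hp.2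
  have hQl : ∀ p ∈ P, (h p).2 = u₂ ∨ (h p).2 = v₂ := fun p hp => (mh hp).2
  -- the levels
  obtain ⟨a, b, hab, la, lb⟩ : ∃ a b : ℝ, ((a = u₂ ∧ b = v₂) ∨ (a = v₂ ∧ b = u₂)) ∧
      (∀ p ∈ P, p.2 = u₁ ↔ (h p).2 = a) ∧ (∀ p ∈ P, p.2 = v₁ ↔ (h p).2 = b) := by
    by_cases hc : ∀ p ∈ P, (p.2 = u₁ ↔ (h p).2 = u₂)
    · refine ⟨u₂, v₂, Or.inl ⟨rfl, rfl⟩, hc, fun p hp => ?_⟩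
      have := hc p hp
      have := hPl p hp
      have := hQl p hp
      grind
    · push Not at hc
      obtain ⟨p₀, hp₀, hc⟩ := hc
      have := hPl p₀ hp₀
      have := hQl p₀ hp₀
      refine ⟨v₂, u₂, Or.inr ⟨rfl, rfl⟩, fun p hp => ?_, fun p hp => ?_⟩
      · have := hPl p hp
        have := hQl p hp
        have := lev p hp p₀ hp₀
        grind
      · have := hPl p hp
        have := hQl p hp
        have := lev p hp p₀ hp₀
        grind
  have hba : b - a ≠ 0 := by
    rcases hab with ⟨rfl, rfl⟩ | ⟨rfl, rfl⟩
    · exact (sub_pos.2 huv₂).ne'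
    · exact (sub_neg.2 huv₂).ne
  have hw : v₁ - u₁ ≠ 0 := (sub_pos.2 huv₁).ne'
  obtain ⟨cf0, ck0, mf0, mk0, li0, ri0, sm0, ext0⟩ := boundary_side P Q h g mh mg hcont cg inv e he
    u₁ a la mono _ _ rfl rfl _ _ rfl rfl
  obtain ⟨cf1, ck1, mf1, mk1, li1, ri1, sm1, ext1⟩ := boundary_side P Q h g mh mg hcont cg inv e he
    v₁ b lb mono _ _ rfl rfl _ _ rfl rfl
  have oA0 := open_side S₁ u₁ v₁ 1 u₁ hS₁ (Or.inl rfl)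
  have oA1 := open_side S₁ u₁ v₁ 1 v₁ hS₁ (Or.inr rfl)
  have oB0 := open_side S₂ u₂ v₂ e a hS₂ (by tauto)
  have oB1 := open_side S₂ u₂ v₂ e b hS₂ (by tauto)
  have n1 := strip_norm S₁ u₁ v₁ 1 u₁ v₁ hS₁ (Or.inl ⟨rfl, rfl⟩)
  have n2 := strip_norm S₂ u₂ v₂ e a b hS₂ hab
  simp only [one_mul] at oA0 oA1 n1
  rw [← hP] at oA0 oA1 n1
  rw [← hQ] at oB0 oB1 n2
  obtain ⟨F, G, mF, mG, cF, cG, iFG, lF, F0, F1⟩ := core _ _ _ _ _ _ _ _ oA0 oB0 oA1 oB1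
    cf0 ck0 cf1 ck1 mf0 mk0 mf1 mk1 li0 ri0 li1 ri1 sm0 sm1
  set N1 : ℝ × ℝ → ℝ × ℝ := fun p => (p.1, u₁ + (v₁ - u₁) * p.2) with hN1
  set M1 : ℝ × ℝ → ℝ × ℝ := fun p => (p.1, (p.2 - u₁) / (v₁ - u₁)) with hM1
  set N2 : ℝ × ℝ → ℝ × ℝ := fun p => (e * p.1, a + (b - a) * p.2) with hN2
  set M2 : ℝ × ℝ → ℝ × ℝ := fun p => (e * p.1, (p.2 - a) / (b - a)) with hM2
  have NM1 : ∀ p, N1 (M1 p) = p := fun p => by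
    apply Prod.ext
    · rfl
    · simp only [hN1, hM1]; field_simp; ring
  have MN1 : ∀ p, M1 (N1 p) = p := fun p => by
    apply Prod.ext
    · rfl
    · simp only [hN1, hM1]; field_simp; ring
  have NM2 : ∀ p, N2 (M2 p) = p := fun p => by
    apply Prod.ext
    · simp only [hN2, hM2]; rw [← mul_assoc, he, one_mul]
    · simp only [hN2, hM2]; field_simp; ring
  have MN2 : ∀ p, M2 (N2 p) = p := fun p => by
    apply Prod.ext
    · simp only [hN2, hM2]; rw [← mul_assoc, he, one_mul]
    · simp only [hN2, hM2]; field_simp; ring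
  have cN1 : Continuous N1 := by fun_prop
  have cM1 : Continuous M1 := by fun_prop
  have cN2 : Continuous N2 := by fun_prop
  have cM2 : Continuous M2 := by fun_prop
  set T1 := nstrip {x | (x, u₁) ∈ P} {x | (x, v₁) ∈ P} with hT1
  set T2 := nstrip {x | (e * x, a) ∈ Q} {x | (e * x, b) ∈ Q} with hT2
  have tN1 : MapsTo N1 T1 S₁ := fun p hp => (n1 p).1 hp
  have tN2 : MapsTo N2 T2 S₂ := fun p hp => (n2 p).1 hp
  have tM1 : MapsTo M1 S₁ T1 := fun p hp => (n1 _).2 (by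
    have := NM1 p
    simp only [hN1] at this
    rw [this]; exact hp)
  have tM2 : MapsTo M2 S₂ T2 := fun p hp => (n2 _).2 (by
    have := NM2 p
    simp only [hN2] at this
    rw [this]; exact hp)
  refine ⟨fun p => N2 (F (M1 p)), foliated_of_level S₁ S₂ _ (fun q => N1 (G (M2 q)))
    (fun p hp => tN2 (mF (tM1 hp))) (fun q hq => tN1 (mG (tM2 hq))) ?_ ?_ ⟨?_, ?_⟩ ?_, ?_⟩
  · exact cN2.comp_continuousOn (cF.comp cM1.continuousOn tM1)
  · exact cN1.comp_continuousOn (cG.comp cM2.continuousOn tM2)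
  · intro p hp
    simp only [MN2]
    rw [iFG.1 (tM1 hp), NM1]
  · intro q hq
    simp only [MN1]
    rw [iFG.2 (tM2 hq), NM2]
  · intro p _ q _
    simp only [hN2, lF, hM1]
    rw [add_right_inj, mul_right_inj' hba, div_left_inj' hw, sub_left_inj]
  · rintro ⟨x, y⟩ hp
    rcases hPl _ hp with rfl | rfl
    · have e1 : M1 (x, y) = (x, 0) := by simp [hM1]
      simp only [e1]
      rw [F0 x hp, ext0 x hp]
      simp [hN2]
      exact Or.inl (by rw [← mul_assoc, he, one_mul])
    · have e1 : M1 (x, y) = (x, 1) := by simp [hM1, hw]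
      simp only [e1]
      rw [F1 x hp, ext1 x hp]
      simp [hN2]
      exact Or.inl (by rw [← mul_assoc, he, one_mul])
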